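/- Let k, m be non-negative integers and n a positive integer with n > k. Then the graph Γ_ℝ(X^{2m+1} Y^{2k+1}, X^{2m+1} Y^{2n}) has girth eight. -/

import Mathlib

/-- The algebraically defined bipartite graph `Γ_R(f₂, f₃)`: the first summand consists of
points `(a₁,a₂,a₃)`, the second of lines `[x₁,x₂,x₃]`; a point is adjacent to a line iff
`a₂ + x₂ = f₂ (a₁, x₁)` and `a₃ + x₃ = f₃ (a₁, x₁)`. -/
def adGraph (R : Type*) [CommRing R] (f₂ f₃ : R × R → R) :
    SimpleGraph ((R × R × R) ⊕ (R × R × R)) :=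
  SimpleGraph.fromRel (fun u v =>
    ∃ a x : R × R × R, u = Sum.inl a ∧ v = Sum.inr x ∧
      a.2.1 + x.2.1 = f₂ (a.1, x.1) ∧ a.2.2 + x.2.2 = f₃ (a.1, x.1))

/-- The real monomial graph `Γ_ℝ(X^s Y^t, X^u Y^v)`. -/
noncomputable def monGraph (s t u v : ℕ) : SimpleGraph ((ℝ × ℝ × ℝ) ⊕ (ℝ × ℝ × ℝ)) :=
  adGraph ℝ (fun p => p.1 ^ s * p.2 ^ t) (fun p => p.1 ^ u * p.2 ^ v)

theorem strictConvexOn_abs_rpow {r : ℝ} (hr : 1 < r) :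
    StrictConvexOn ℝ Set.univ fun t : ℝ => |t| ^ r := by
  have hderiv : deriv (fun t : ℝ => |t| ^ r) = fun t => r * |t| ^ (r - 2) * t :=
    funext fun t => (hasDerivAt_abs_rpow t hr).deriv
  refine StrictMonoOn.strictConvexOn_of_deriv convex_univ
    (fun t _ => (hasDerivAt_abs_rpow t hr).continuousAt.continuousWithinAt) ?_
  rw [interior_univ, strictMonoOn_univ, hderiv]
  refine strictMono_of_odd_strictMonoOn_nonneg (fun t => by simp) ?_
  have heq : Set.EqOn (fun t : ℝ => r * t ^ (r - 1)) (fun t => r * |t| ^ (r - 2) * t)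
      (Set.Ici 0) := by
    intro t ht
    rcases eq_or_lt_of_le (Set.mem_Ici.1 ht) with rfl | ht
    · simp [Real.zero_rpow (sub_pos.2 hr).ne']
    · have h : r - 1 = (r - 2) + 1 := by ring
      simp only [abs_of_pos ht, h, Real.rpow_add_one ht.ne']
      ring
  refine StrictMonoOn.congr (fun s hs t _ hst => ?_) heq
  exact mul_lt_mul_of_pos_left (Real.rpow_lt_rpow hs hst (sub_pos.2 hr)) (by linarith)

theorem StrictConvexOn.not_collinear {f : ℝ → ℝ} (hf : StrictConvexOn ℝ Set.univ f) {x y z : ℝ}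
    (hxy : x ≠ y) (hyz : y ≠ z) (hxz : x ≠ z) :
    (x - z) * (f y - f z) ≠ (f x - f z) * (y - z) := by
  have key : ∀ {a b c : ℝ}, a < b → b < c → (f b - f a) * (c - b) < (f c - f b) * (b - a) := by
    intro a b c hab hbc
    have h := hf.slope_strict_mono_adjacent (Set.mem_univ a) (Set.mem_univ c) hab hbc
    rwa [div_lt_div_iff₀ (sub_pos.2 hab) (sub_pos.2 hbc)] at h
  intro h
  rcases hxy.lt_or_gt with h₁ | h₁ <;> rcases hyz.lt_or_gt with h₂ | h₂ <;>
    rcases hxz.lt_or_gt with h₃ | h₃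
  · linarith [key h₁ h₂]
  · linarith
  · linarith [key h₃ h₂]
  · linarith [key h₃ h₁]
  · linarith [key h₁ h₃]
  · linarith [key h₂ h₃]
  · linarith
  · linarith [key h₂ h₁]

theorem odd_pow_even_pow_not_collinear {k n : ℕ} (hkn : k < n) {x y z : ℝ}
    (hxy : x ≠ y) (hyz : y ≠ z) (hxz : x ≠ z) :
    (x ^ (2 * k + 1) - z ^ (2 * k + 1)) * (y ^ (2 * n) - z ^ (2 * n)) ≠
      (x ^ (2 * n) - z ^ (2 * n)) * (y ^ (2 * k + 1) - z ^ (2 * k + 1)) := by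
  have hpos : (0 : ℝ) < ((2 * k + 1 : ℕ) : ℝ) := by positivity
  have hr : 1 < ((2 * n : ℕ) : ℝ) / ((2 * k + 1 : ℕ) : ℝ) := by
    rw [one_lt_div hpos]
    exact_mod_cast (by omega : 2 * k + 1 < 2 * n)
  have hpow : ∀ t : ℝ,
      |t ^ (2 * k + 1)| ^ (((2 * n : ℕ) : ℝ) / ((2 * k + 1 : ℕ) : ℝ)) = t ^ (2 * n) := by
    intro t
    rw [abs_pow, ← Real.rpow_natCast, ← Real.rpow_mul (abs_nonneg t),
      mul_div_cancel₀ _ hpos.ne', Real.rpow_natCast, (even_two_mul n).pow_abs]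
  have hinj : Function.Injective fun t : ℝ => t ^ (2 * k + 1) :=
    (odd_two_mul_add_one k).strictMono_pow.injective
  simpa only [hpow] using
    (strictConvexOn_abs_rpow hr).not_collinear (hinj.ne hxy) (hinj.ne hyz) (hinj.ne hxz)

section adGraph

variable {R : Type*} [CommRing R] {f₂ f₃ : R × R → R}

@[simp]
theorem adGraph_adj_inl_inr {a x : R × R × R} :
    (adGraph R f₂ f₃).Adj (.inl a) (.inr x) ↔
      a.2.1 + x.2.1 = f₂ (a.1, x.1) ∧ a.2.2 + x.2.2 = f₃ (a.1, x.1) := by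
  simp [adGraph, -Prod.exists]

@[simp]
theorem adGraph_adj_inr_inl {a x : R × R × R} :
    (adGraph R f₂ f₃).Adj (.inr x) (.inl a) ↔
      a.2.1 + x.2.1 = f₂ (a.1, x.1) ∧ a.2.2 + x.2.2 = f₃ (a.1, x.1) := by
  simp [adGraph, -Prod.exists]

@[simp]
theorem not_adGraph_adj_inl_inl {a b : R × R × R} :
    ¬ (adGraph R f₂ f₃).Adj (.inl a) (.inl b) := by
  simp [adGraph]

@[simp]
theorem not_adGraph_adj_inr_inr {x y : R × R × R} :
    ¬ (adGraph R f₂ f₃).Adj (.inr x) (.inr y) := by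
  simp [adGraph]

theorem exists_eq_inr_of_adGraph_adj_inl {a : R × R × R} {p : (R × R × R) ⊕ (R × R × R)}
    (h : (adGraph R f₂ f₃).Adj (.inl a) p) : ∃ x, p = .inr x := by
  rcases p with b | x
  · exact absurd h not_adGraph_adj_inl_inl
  · exact ⟨x, rfl⟩

theorem exists_eq_inl_of_adGraph_adj_inr {x : R × R × R} {p : (R × R × R) ⊕ (R × R × R)}
    (h : (adGraph R f₂ f₃).Adj (.inr x) p) : ∃ a, p = .inl a := by
  rcases p with a | y
  · exact ⟨a, rfl⟩
  · exact absurd h not_adGraph_adj_inr_inr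

/-- The proper two-colouring of `adGraph` that separates points from lines. -/
def adGraphSideColoring (f₂ f₃ : R × R → R) : (adGraph R f₂ f₃).Coloring Bool :=
  SimpleGraph.Coloring.mk Sum.isLeft fun {p q} h => by
    rcases p with a | x <;> rcases q with b | y <;> simp at h ⊢

theorem adGraph_point_fst_ne {a b x : R × R × R} (hab : a ≠ b)
    (ha : (adGraph R f₂ f₃).Adj (.inl a) (.inr x))
    (hb : (adGraph R f₂ f₃).Adj (.inl b) (.inr x)) : a.1 ≠ b.1 := by
  rw [adGraph_adj_inl_inr] at ha hb
  intro h
  rw [h] at ha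
  exact hab (Prod.ext h (Prod.ext (add_right_cancel (ha.1.trans hb.1.symm))
    (add_right_cancel (ha.2.trans hb.2.symm))))

theorem adGraph_line_fst_ne {a x y : R × R × R} (hxy : x ≠ y)
    (hx : (adGraph R f₂ f₃).Adj (.inl a) (.inr x))
    (hy : (adGraph R f₂ f₃).Adj (.inl a) (.inr y)) : x.1 ≠ y.1 := by
  rw [adGraph_adj_inl_inr] at hx hy
  intro h
  rw [h] at hx
  exact hxy (Prod.ext h (Prod.ext (add_left_cancel (hx.1.trans hy.1.symm))
    (add_left_cancel (hx.2.trans hy.2.symm))))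

end adGraph

theorem monGraph_no_four_cycle {k m u v : ℕ} {a b x y : ℝ × ℝ × ℝ} (hab : a ≠ b) (hxy : x ≠ y)
    (hax : (monGraph (2 * m + 1) (2 * k + 1) u v).Adj (.inl a) (.inr x))
    (hbx : (monGraph (2 * m + 1) (2 * k + 1) u v).Adj (.inl b) (.inr x))
    (hby : (monGraph (2 * m + 1) (2 * k + 1) u v).Adj (.inl b) (.inr y))
    (hay : (monGraph (2 * m + 1) (2 * k + 1) u v).Adj (.inl a) (.inr y)) : False := by
  have hA := (odd_two_mul_add_one m).strictMono_pow.injective.ne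
    (adGraph_point_fst_ne hab hax hbx)
  have hX := (odd_two_mul_add_one k).strictMono_pow.injective.ne
    (adGraph_line_fst_ne hxy hax hay)
  simp only [monGraph, adGraph_adj_inl_inr] at hax hbx hby hay
  refine mul_ne_zero (sub_ne_zero.2 hA) (sub_ne_zero.2 hX) ?_
  linear_combination -hax.1 + hbx.1 - hby.1 + hay.1

theorem monGraph_no_six_cycle {k m n : ℕ} (hkn : k < n) {a b c x y z : ℝ × ℝ × ℝ}
    (hab : a ≠ b) (hxy : x ≠ y) (hyz : y ≠ z) (hxz : x ≠ z)
    (hax : (monGraph (2 * m + 1) (2 * k + 1) (2 * m + 1) (2 * n)).Adj (.inl a) (.inr x))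
    (hbx : (monGraph (2 * m + 1) (2 * k + 1) (2 * m + 1) (2 * n)).Adj (.inl b) (.inr x))
    (hby : (monGraph (2 * m + 1) (2 * k + 1) (2 * m + 1) (2 * n)).Adj (.inl b) (.inr y))
    (hcy : (monGraph (2 * m + 1) (2 * k + 1) (2 * m + 1) (2 * n)).Adj (.inl c) (.inr y))
    (hcz : (monGraph (2 * m + 1) (2 * k + 1) (2 * m + 1) (2 * n)).Adj (.inl c) (.inr z))
    (haz : (monGraph (2 * m + 1) (2 * k + 1) (2 * m + 1) (2 * n)).Adj (.inl a) (.inr z)) :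
    False := by
  have hA := (odd_two_mul_add_one m).strictMono_pow.injective.ne
    (adGraph_point_fst_ne hab hax hbx)
  refine odd_pow_even_pow_not_collinear hkn (adGraph_line_fst_ne hxy hbx hby)
    (adGraph_line_fst_ne hyz hcy hcz) (adGraph_line_fst_ne hxz hax haz) ?_
  simp only [monGraph, adGraph_adj_inl_inr] at hax hbx hby hcy hcz haz
  have h₂ : (a.1 ^ (2 * m + 1) - b.1 ^ (2 * m + 1)) * (x.1 ^ (2 * k + 1) - z.1 ^ (2 * k + 1)) +
      (b.1 ^ (2 * m + 1) - c.1 ^ (2 * m + 1)) * (y.1 ^ (2 * k + 1) - z.1 ^ (2 * k + 1)) = 0 := by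
    linear_combination -hax.1 + hbx.1 - hby.1 + hcy.1 - hcz.1 + haz.1
  have h₃ : (a.1 ^ (2 * m + 1) - b.1 ^ (2 * m + 1)) * (x.1 ^ (2 * n) - z.1 ^ (2 * n)) +
      (b.1 ^ (2 * m + 1) - c.1 ^ (2 * m + 1)) * (y.1 ^ (2 * n) - z.1 ^ (2 * n)) = 0 := by
    linear_combination -hax.2 + hbx.2 - hby.2 + hcy.2 - hcz.2 + haz.2
  refine mul_left_cancel₀ (sub_ne_zero.2 hA) ?_
  linear_combination (y.1 ^ (2 * n) - z.1 ^ (2 * n)) * h₂ -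
    (y.1 ^ (2 * k + 1) - z.1 ^ (2 * k + 1)) * h₃

theorem monGraph_eight_le_length {k m n : ℕ} (hkn : k < n) {p : (ℝ × ℝ × ℝ) ⊕ (ℝ × ℝ × ℝ)}
    (w : (monGraph (2 * m + 1) (2 * k + 1) (2 * m + 1) (2 * n)).Walk p p) (hw : w.IsCycle) :
    8 ≤ w.length := by
  by_contra! hlt
  have hthree := hw.three_le_length
  have heven : Even w.length :=
    ((adGraphSideColoring _ _).even_length_iff_congr w).2 Iff.rfl
  have hadj : ∀ i < w.length, (monGraph (2 * m + 1) (2 * k + 1) (2 * m + 1) (2 * n)).Adj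
      (w.getVert i) (w.getVert (i + 1)) := fun i hi => w.adj_getVert_succ hi
  have hclosed : w.getVert w.length = w.getVert 0 := by simp
  have hinj : ∀ i < w.length, ∀ j < w.length, i ≠ j → w.getVert i ≠ w.getVert j :=
    fun i hi j hj hij h =>
      hij (hw.getVert_injOn' (Nat.le_sub_one_of_lt hi) (Nat.le_sub_one_of_lt hj) h)
  generalize w.getVert = v at hadj hclosed hinj
  generalize w.length = L at *
  have hright : ∀ i < L, ∀ a, v i = .inl a → ∃ x, v (i + 1) = .inr x := fun i hi a ha =>
    exists_eq_inr_of_adGraph_adj_inl (ha ▸ hadj i hi)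
  have hleft : ∀ i < L, ∀ x, v i = .inr x → ∃ a, v (i + 1) = .inl a := fun i hi x hx =>
    exists_eq_inl_of_adGraph_adj_inr (hx ▸ hadj i hi)
  obtain rfl | rfl : L = 4 ∨ L = 6 := by
    obtain ⟨l, rfl⟩ := heven
    omega
  · have e₀ := hadj 0 (by omega)
    have e₁ := hadj 1 (by omega)
    have e₂ := hadj 2 (by omega)
    have e₃ := hadj 3 (by omega)
    have d₀ := hinj 0 (by omega) 2 (by omega) (by omega)
    have d₁ := hinj 1 (by omega) 3 (by omega) (by omega)
    rcases h₀ : v 0 with a | x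
    · obtain ⟨x, h₁⟩ := hright 0 (by omega) a h₀
      obtain ⟨b, h₂⟩ := hleft 1 (by omega) x h₁
      obtain ⟨y, h₃⟩ := hright 2 (by omega) b h₂
      simp only [zero_add, Nat.reduceAdd, hclosed, h₀, h₁, h₂, h₃, ne_eq, Sum.inl.injEq,
        Sum.inr.injEq] at e₀ e₁ e₂ e₃ d₀ d₁
      exact monGraph_no_four_cycle d₀ d₁ e₀ e₁.symm e₂ e₃.symm
    · obtain ⟨a, h₁⟩ := hleft 0 (by omega) x h₀
      obtain ⟨y, h₂⟩ := hright 1 (by omega) a h₁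
      obtain ⟨b, h₃⟩ := hleft 2 (by omega) y h₂
      simp only [zero_add, Nat.reduceAdd, hclosed, h₀, h₁, h₂, h₃, ne_eq, Sum.inl.injEq,
        Sum.inr.injEq] at e₀ e₁ e₂ e₃ d₀ d₁
      exact monGraph_no_four_cycle d₁ (Ne.symm d₀) e₁ e₂.symm e₃ e₀.symm
  · have e₀ := hadj 0 (by omega)
    have e₁ := hadj 1 (by omega)
    have e₂ := hadj 2 (by omega)
    have e₃ := hadj 3 (by omega)
    have e₄ := hadj 4 (by omega)
    have e₅ := hadj 5 (by omega)
    have d₀₂ := hinj 0 (by omega) 2 (by omega) (by omega)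
    have d₁₃ := hinj 1 (by omega) 3 (by omega) (by omega)
    have d₂₄ := hinj 2 (by omega) 4 (by omega) (by omega)
    have d₃₅ := hinj 3 (by omega) 5 (by omega) (by omega)
    have d₀₄ := hinj 0 (by omega) 4 (by omega) (by omega)
    have d₁₅ := hinj 1 (by omega) 5 (by omega) (by omega)
    rcases h₀ : v 0 with a | x
    · obtain ⟨x, h₁⟩ := hright 0 (by omega) a h₀
      obtain ⟨b, h₂⟩ := hleft 1 (by omega) x h₁
      obtain ⟨y, h₃⟩ := hright 2 (by omega) b h₂
      obtain ⟨c, h₄⟩ := hleft 3 (by omega) y h₃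
      obtain ⟨z, h₅⟩ := hright 4 (by omega) c h₄
      simp only [zero_add, Nat.reduceAdd, hclosed, h₀, h₁, h₂, h₃, h₄, h₅, ne_eq, Sum.inl.injEq,
        Sum.inr.injEq] at e₀ e₁ e₂ e₃ e₄ e₅ d₀₂ d₁₃ d₃₅ d₁₅
      exact monGraph_no_six_cycle hkn d₀₂ d₁₃ d₃₅ d₁₅ e₀ e₁.symm e₂ e₃.symm e₄ e₅.symm
    · obtain ⟨a, h₁⟩ := hleft 0 (by omega) x h₀
      obtain ⟨y, h₂⟩ := hright 1 (by omega) a h₁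
      obtain ⟨b, h₃⟩ := hleft 2 (by omega) y h₂
      obtain ⟨z, h₄⟩ := hright 3 (by omega) b h₃
      obtain ⟨c, h₅⟩ := hleft 4 (by omega) z h₄
      simp only [zero_add, Nat.reduceAdd, hclosed, h₀, h₁, h₂, h₃, h₄, h₅, ne_eq, Sum.inl.injEq,
        Sum.inr.injEq] at e₀ e₁ e₂ e₃ e₄ e₅ d₀₂ d₁₃ d₂₄ d₀₄
      exact monGraph_no_six_cycle hkn d₁₃ d₂₄ (Ne.symm d₀₄) (Ne.symm d₀₂)
        e₁ e₂.symm e₃ e₄.symm e₅ e₀.symm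

theorem monGraph_exists_cycle_length_eight {k m n : ℕ} (hn : 0 < n) :
    ∃ (p : (ℝ × ℝ × ℝ) ⊕ (ℝ × ℝ × ℝ))
      (w : (monGraph (2 * m + 1) (2 * k + 1) (2 * m + 1) (2 * n)).Walk p p),
      w.IsCycle ∧ w.length = 8 := by
  have hn' : n ≠ 0 := hn.ne'
  have hm : (-1 : ℝ) ^ (2 * m + 1) = -1 := (odd_two_mul_add_one m).neg_one_pow
  have h₁ : (monGraph (2 * m + 1) (2 * k + 1) (2 * m + 1) (2 * n)).Adj
      (.inl (0, 0, 0)) (.inr (0, 0, 0)) := by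
    simp [monGraph, hn']
  have h₂ : (monGraph (2 * m + 1) (2 * k + 1) (2 * m + 1) (2 * n)).Adj
      (.inr (0, 0, 0)) (.inl (1, 0, 0)) := by
    simp [monGraph, hn']
  have h₃ : (monGraph (2 * m + 1) (2 * k + 1) (2 * m + 1) (2 * n)).Adj
      (.inl (1, 0, 0)) (.inr (1, 1, 1)) := by
    simp [monGraph]
  have h₄ : (monGraph (2 * m + 1) (2 * k + 1) (2 * m + 1) (2 * n)).Adj
      (.inr (1, 1, 1)) (.inl (0, -1, -1)) := by
    simp [monGraph]
  have h₅ : (monGraph (2 * m + 1) (2 * k + 1) (2 * m + 1) (2 * n)).Adj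
      (.inl (0, -1, -1)) (.inr (0, 1, 1)) := by
    simp [monGraph, hn']
  have h₆ : (monGraph (2 * m + 1) (2 * k + 1) (2 * m + 1) (2 * n)).Adj
      (.inr (0, 1, 1)) (.inl (-1, -1, -1)) := by
    simp [monGraph, hn', hm]
  have h₇ : (monGraph (2 * m + 1) (2 * k + 1) (2 * m + 1) (2 * n)).Adj
      (.inl (-1, -1, -1)) (.inr (1, 0, 0)) := by
    simp [monGraph, hm]
  have h₈ : (monGraph (2 * m + 1) (2 * k + 1) (2 * m + 1) (2 * n)).Adj
      (.inr (1, 0, 0)) (.inl (0, 0, 0)) := by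
    simp [monGraph]
  refine ⟨_, .cons h₁ <| .cons h₂ <| .cons h₃ <| .cons h₄ <| .cons h₅ <| .cons h₆ <|
    .cons h₇ <| .cons h₈ .nil, ?_, ?_⟩
  · simp only [SimpleGraph.Walk.isCycle_def, SimpleGraph.Walk.isTrail_def]
    norm_num [Sum.inl_ne_inr, Sum.inr_ne_inl]
  · simp

theorem girth_eight (k m n : ℕ) (hn : 0 < n) (hkn : k < n) :
    (monGraph (2 * m + 1) (2 * k + 1) (2 * m + 1) (2 * n)).egirth = 8 := by
  obtain ⟨p, w, hw, hlen⟩ := monGraph_exists_cycle_length_eight (k := k) (m := m) hn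
  refine le_antisymm ?_ (SimpleGraph.le_egirth.2 fun p w hw => ?_)
  · simpa [hlen] using SimpleGraph.le_egirth.1 le_rfl p w hw
  · exact_mod_cast monGraph_eight_le_length hkn w hw
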